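/- For every radius r with 0 < r < π, the circle integral of the meromorphic function w ↦ e^{i√3 w} cosh⁴(w)/sinh⁵(w) over the circle |w| = r (oriented counterclockwise) equals 2πi · (−1) = −2πi. Equivalently, the residue at w = 0 of e^{i√3 w} cosh⁴(w)/sinh⁵(w) is −1. -/

import Mathlib

theorem Complex.sinh_ne_zero_of_norm_lt_pi {w : ℂ} (hw : w ≠ 0) (hπ : ‖w‖ < Real.pi) :
    Complex.sinh w ≠ 0 := by
  intro h
  have h1 : Complex.sin (w * Complex.I) = 0 := by rw [Complex.sin_mul_I, h, zero_mul]
  obtain ⟨k, hk⟩ := Complex.sin_eq_zero_iff.1 h1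
  have hn : ‖w‖ = |(k : ℝ)| * Real.pi := by
    have := congrArg norm hk
    simpa [abs_of_pos Real.pi_pos] using this
  have hk0 : k ≠ 0 := by
    rintro rfl
    simp at hk
    exact hw hk
  have h2 : (1 : ℝ) ≤ |(k : ℝ)| := by exact_mod_cast Int.one_le_abs hk0
  nlinarith [Real.pi_pos]

theorem circleIntegral_exp_mul_div_sinh (a : ℂ) {r : ℝ} (hr0 : 0 < r) (hrπ : r < Real.pi) :
    (∮ w in C(0, r), Complex.exp (a * w) / Complex.sinh w) = 2 * Real.pi * Complex.I := by
  have hg : Differentiable ℂ (dslope Complex.sinh 0) := by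
    rw [← differentiableOn_univ, Complex.differentiableOn_dslope Filter.univ_mem]
    exact Complex.differentiable_sinh.differentiableOn
  have hg0 : dslope Complex.sinh 0 0 = 1 := by simp [dslope_same]
  have hmul (w : ℂ) : w * dslope Complex.sinh 0 w = Complex.sinh w := by
    simpa using sub_smul_dslope Complex.sinh 0 w
  have hne : ∀ w ∈ Metric.closedBall (0 : ℂ) r, dslope Complex.sinh 0 w ≠ 0 := by
    intro w hw h
    rcases eq_or_ne w 0 with rfl | hw0
    · simp at h
    · refine Complex.sinh_ne_zero_of_norm_lt_pi hw0
        ((mem_closedBall_zero_iff.1 hw).trans_lt hrπ) ?_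
      rw [← hmul, h, mul_zero]
  have hd : DifferentiableOn ℂ (fun w => Complex.exp (a * w) / dslope Complex.sinh 0 w)
      (Metric.closedBall 0 r) :=
    DifferentiableOn.div (by fun_prop) hg.differentiableOn hne
  have := hd.circleIntegral_sub_inv_smul (Metric.mem_ball_self hr0)
  simp only [hg0, mul_zero, Complex.exp_zero, div_one, smul_eq_mul, mul_one, sub_zero] at this
  rw [← this]
  refine circleIntegral.integral_congr hr0.le fun w _ => ?_
  simp only [← hmul w]
  rw [mul_comm w, ← div_div, div_eq_inv_mul _ w]

theorem hasDerivAt_exp_mul_coth_primitive {a : ℂ} (ha : a ^ 2 = -3) {w : ℂ}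
    (hw : Complex.sinh w ≠ 0) :
    HasDerivAt (fun z => -(1 / 12) * (Complex.exp (a * z) *
        (5 * a * Complex.sinh z ^ 3 + 3 * Complex.cosh z * Complex.sinh z ^ 2
          + a * Complex.cosh z ^ 2 * Complex.sinh z + 3 * Complex.cosh z ^ 3)
          / Complex.sinh z ^ 4))
      (Complex.exp (a * w) * Complex.cosh w ^ 4 / Complex.sinh w ^ 5
        + Complex.exp (a * w) / Complex.sinh w) w := by
  have hs := Complex.hasDerivAt_sinh w
  have hc := Complex.hasDerivAt_cosh w
  have he : HasDerivAt (fun z => Complex.exp (a * z)) (Complex.exp (a * w) * a) w := by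
    simpa using ((hasDerivAt_id w).const_mul a).cexp
  have hP := ((((hs.pow 3).const_mul (5 * a)).add ((hc.const_mul 3).mul (hs.pow 2))).add
    (((hc.pow 2).const_mul a).mul hs)).add ((hc.pow 3).const_mul 3)
  have := ((he.mul hP).div (hs.pow 4) (pow_ne_zero 4 hw)).const_mul (-(1 / 12))
  refine this.congr_deriv ?_
  have hcs := Complex.cosh_sq w
  simp only [Pi.add_apply, Pi.mul_apply, Pi.pow_apply]
  generalize Complex.exp (a * w) = e at *
  generalize Complex.sinh w = s at *
  generalize Complex.cosh w = c at *
  field_simp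
  grind

/-- The residue of `e^{i√3 w} cosh⁴ w / sinh⁵ w` at `w = 0` is `−1`: for `0 < r < π`,
the counterclockwise circle integral over `|w| = r` equals `2πi · (−1) = −2πi`. -/
theorem residue_cosh4_sinh5 (r : ℝ) (hr0 : 0 < r) (hrπ : r < Real.pi) :
    (∮ w in C(0, r),
        Complex.exp (Complex.I * Real.sqrt 3 * w) * Complex.cosh w ^ 4 / Complex.sinh w ^ 5)
      = 2 * Real.pi * Complex.I * (-1) := by
  have ha : (Complex.I * Real.sqrt 3) ^ 2 = (-3 : ℂ) := by
    rw [mul_pow, Complex.I_sq, ← Complex.ofReal_pow, Real.sq_sqrt (by norm_num)]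
    norm_num
  generalize Complex.I * (Real.sqrt 3 : ℂ) = a at ha ⊢
  have hne : ∀ w ∈ Metric.sphere (0 : ℂ) r, Complex.sinh w ≠ 0 := fun w hw =>
    Complex.sinh_ne_zero_of_norm_lt_pi (ne_zero_of_mem_sphere hr0.ne' ⟨w, hw⟩)
      ((mem_sphere_zero_iff_norm.1 hw).trans_lt hrπ)
  have hi1 : CircleIntegrable (fun w => Complex.exp (a * w) * Complex.cosh w ^ 4
      / Complex.sinh w ^ 5) 0 r :=
    ContinuousOn.circleIntegrable hr0.le <|
      ContinuousOn.div (by fun_prop) (by fun_prop) fun w hw => pow_ne_zero 5 (hne w hw)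
  have hi2 : CircleIntegrable (fun w => Complex.exp (a * w) / Complex.sinh w) 0 r :=
    ContinuousOn.circleIntegrable hr0.le <| ContinuousOn.div (by fun_prop) (by fun_prop) hne
  have h0 := circleIntegral.integral_eq_zero_of_hasDerivWithinAt hr0.le fun w hw =>
    (hasDerivAt_exp_mul_coth_primitive ha (hne w hw)).hasDerivWithinAt
  rw [circleIntegral.integral_add hi1 hi2, circleIntegral_exp_mul_div_sinh a hr0 hrπ] at h0
  linear_combination h0
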